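/- arXiv:2110.15335 — 2 statements merged into one kernel-verified Lean document; each statement's English description precedes it below -/
import Mathlib

section
/- Let (Ω, P) be a probability space, Θ and Y standard Borel spaces, N a positive integer, and let θ : Ω → Θ and Y_0, …, Y_{N−1} : Ω → Y be measurable random variables. For 0 ≤ k ≤ N let π_k : Y^k → P(Θ) be a regular conditional distribution of θ given the random vector (Y_0, …, Y_{k−1}), with π_0 equal to the (unconditional) law of θ. Then, as an identity in the extended nonnegative reals [0, ∞], Σ_{k=0}^{N−1} E[ D_KL( π_{k+1}(Y_0,…,Y_k) ‖ π_k(Y_0,…,Y_{k−1}) ) ] = E[ D_KL( π_N(Y_0,…,Y_{N−1}) ‖ π_0 ) ]. (Equivalence of the incremental and terminal expected information-gain formulations of sequential optimal experimental design, Theorem 2.1; the deterministic designs d_k = μ_k(x_k) are measurable functions of the observation history and are absorbed into the joint law of (θ, Y_0,…,Y_{N−1}).) -/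
open MeasureTheory ProbabilityTheory ENNReal
open scoped Classical

/-- Kullback–Leibler divergence `D_KL(P‖Q) = ∫ log (dP/dQ) dP ∈ [0,∞]`,
equal to `∞` when `P` is not absolutely continuous w.r.t. `Q` (or when the
log-likelihood ratio is not integrable). -/
noncomputable def klDiv {α : Type*} [MeasurableSpace α] (P Q : Measure α) : ℝ≥0∞ :=
  if P ≪ Q ∧ Integrable (llr P Q) P then ENNReal.ofReal (∫ a, llr P Q a ∂P) else ⊤


namespace IncTerm

lemma klDiv_eq {α : Type*} [MeasurableSpace α] (P Q : Measure α)
    [IsProbabilityMeasure P] [IsProbabilityMeasure Q] :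
    klDiv P Q = InformationTheory.klDiv P Q := by
  rw [InformationTheory.klDiv_def, klDiv]
  simp

section kernels

variable {A B : Type*} [MeasurableSpace A] [MeasurableSpace B] [StandardBorelSpace B]

lemma klDiv_kernel_eq (κ η : Kernel A B) [IsMarkovKernel κ] [IsMarkovKernel η] (a : A) :
    klDiv (κ a) (η a) = if κ a ≪ η a then
      ∫⁻ x, ENNReal.ofReal (InformationTheory.klFun (Kernel.rnDeriv κ η a x).toReal) ∂(η a)
      else ⊤ := by
  rw [klDiv_eq, InformationTheory.klDiv_eq_lintegral_klFun]
  split_ifs with h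
  · refine lintegral_congr_ae ?_
    filter_upwards [Kernel.rnDeriv_eq_rnDeriv_measure (κ := κ) (η := η) (a := a)] with x hx
    rw [hx]
  · rfl

lemma measurable_integrand (κ η : Kernel A B) :
    Measurable (fun p : A × B =>
      ENNReal.ofReal (InformationTheory.klFun (Kernel.rnDeriv κ η p.1 p.2).toReal)) :=
  (InformationTheory.measurable_klFun.comp
    (Kernel.measurable_rnDeriv κ η).ennreal_toReal).ennreal_ofReal

lemma measurable_klDiv_kernel (κ η : Kernel A B) [IsMarkovKernel κ] [IsMarkovKernel η] :
    Measurable (fun a => klDiv (κ a) (η a)) := by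
  simp_rw [klDiv_kernel_eq]
  refine Measurable.ite (Kernel.measurableSet_absolutelyContinuous κ η) ?_ measurable_const
  exact Measurable.lintegral_kernel_prod_right' (measurable_integrand κ η)

lemma compProd_eq_withDensity (μ : Measure A) [IsProbabilityMeasure μ]
    (κ η : Kernel A B) [IsMarkovKernel κ] [IsMarkovKernel η] (h : ∀ᵐ a ∂μ, κ a ≪ η a) :
    μ ⊗ₘ κ = (μ ⊗ₘ η).withDensity (fun p => Kernel.rnDeriv κ η p.1 p.2) := by
  ext s hs
  rw [withDensity_apply _ hs, ← lintegral_indicator hs,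
    Measure.lintegral_compProd ((Kernel.measurable_rnDeriv κ η).indicator hs),
    Measure.compProd_apply hs]
  refine lintegral_congr_ae ?_
  filter_upwards [h] with a ha
  rw [← Kernel.setLIntegral_rnDeriv ha (measurable_prodMk_left hs),
    ← lintegral_indicator (measurable_prodMk_left hs)]
  rfl

lemma klDiv_compProd_right (μ : Measure A) [IsProbabilityMeasure μ]
    (κ η : Kernel A B) [IsMarkovKernel κ] [IsMarkovKernel η] :
    InformationTheory.klDiv (μ ⊗ₘ κ) (μ ⊗ₘ η) = ∫⁻ a, klDiv (κ a) (η a) ∂μ := by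
  rw [InformationTheory.klDiv_eq_lintegral_klFun, Measure.absolutelyContinuous_compProd_right_iff]
  split_ifs with h
  · have h1 : (μ ⊗ₘ κ).rnDeriv (μ ⊗ₘ η) =ᵐ[μ ⊗ₘ η] fun p => Kernel.rnDeriv κ η p.1 p.2 := by
      rw [compProd_eq_withDensity μ κ η h]
      exact Measure.rnDeriv_withDensity _ (Kernel.measurable_rnDeriv κ η)
    have h2 : ∫⁻ x, ENNReal.ofReal
          (InformationTheory.klFun ((μ ⊗ₘ κ).rnDeriv (μ ⊗ₘ η) x).toReal) ∂(μ ⊗ₘ η)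
        = ∫⁻ p, ENNReal.ofReal
          (InformationTheory.klFun (Kernel.rnDeriv κ η p.1 p.2).toReal) ∂(μ ⊗ₘ η) := by
      refine lintegral_congr_ae ?_
      filter_upwards [h1] with p hp
      rw [hp]
    rw [h2, Measure.lintegral_compProd (measurable_integrand κ η)]
    refine lintegral_congr_ae ?_
    filter_upwards [h] with a ha
    rw [klDiv_kernel_eq, if_pos ha]
  · by_contra hne
    apply h
    filter_upwards [ae_lt_top (measurable_klDiv_kernel κ η) (Ne.symm hne)] with a ha
    by_contra hac
    rw [klDiv_kernel_eq, if_neg hac] at ha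
    exact lt_irrefl _ ha

end kernels

lemma klDiv_map_equiv {A B : Type*} [MeasurableSpace A] [MeasurableSpace B] (e : A ≃ᵐ B)
    (μ ν : Measure A) [IsFiniteMeasure μ] [IsFiniteMeasure ν] :
    InformationTheory.klDiv (μ.map e) (ν.map e) = InformationTheory.klDiv μ ν := by
  refine le_antisymm (InformationTheory.klDiv_map_le μ ν e.measurable) ?_
  have := InformationTheory.klDiv_map_le (μ.map e) (ν.map e) e.symm.measurable
  simpa using this

section chain

variable {A B T : Type*} [MeasurableSpace A] [MeasurableSpace B] [MeasurableSpace T]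
  [StandardBorelSpace B] [Nonempty B]

/-- swap the last two coordinates -/
def sw (A B T : Type*) [MeasurableSpace A] [MeasurableSpace B] [MeasurableSpace T] :
    (A × B) × T ≃ᵐ (A × T) × B where
  toFun p := ((p.1.1, p.2), p.1.2)
  invFun p := ((p.1.1, p.2), p.1.2)
  left_inv _ := rfl
  right_inv _ := rfl
  measurable_toFun := by simp only [Equiv.coe_fn_mk]; fun_prop
  measurable_invFun := by simp only [Equiv.coe_fn_symm_mk]; fun_prop

lemma map_sw_compProd (m : Measure (A × B)) [IsProbabilityMeasure m]
    (κ : Kernel A T) [IsMarkovKernel κ] :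
    (m ⊗ₘ (κ.comap Prod.fst measurable_fst)).map (sw A B T)
      = (m.fst ⊗ₘ κ) ⊗ₘ (m.condKernel.comap Prod.fst measurable_fst) := by
  refine Measure.ext_of_lintegral _ fun f hf => ?_
  have hfs : Measurable (fun p => f (sw A B T p)) := hf.comp (sw A B T).measurable
  rw [lintegral_map hf (sw A B T).measurable,
    Measure.lintegral_compProd hfs,
    Measure.lintegral_compProd hf, Measure.lintegral_compProd
      (Measurable.lintegral_kernel_prod_right' hf)]
  have hm := m.disintegrate m.condKernel
  conv_lhs => rw [← hm]
  rw [Measure.lintegral_compProd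
    (Measurable.lintegral_kernel_prod_right' hfs)]
  refine lintegral_congr fun a => ?_
  simp only [Kernel.comap_apply]
  rw [lintegral_lintegral_swap]
  · rfl
  · refine Measurable.aemeasurable ?_
    exact hfs.comp
      (f := fun p : B × T => ((a, p.1), p.2)) (by fun_prop)

lemma chain (m : Measure (A × B)) [IsProbabilityMeasure m]
    (κ' : Kernel (A × B) T) [IsMarkovKernel κ'] (κ : Kernel A T) [IsMarkovKernel κ]
    (l : Measure T) [IsProbabilityMeasure l]
    (h : (m ⊗ₘ κ').map (fun p => (p.1.1, p.2)) = m.fst ⊗ₘ κ) :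
    InformationTheory.klDiv (m ⊗ₘ κ') (m ⊗ₘ Kernel.const _ l)
      = InformationTheory.klDiv (m.fst ⊗ₘ κ) (m.fst ⊗ₘ Kernel.const _ l)
        + InformationTheory.klDiv (m ⊗ₘ κ') (m ⊗ₘ (κ.comap Prod.fst measurable_fst)) := by
  have hc : (Kernel.const (A × B) l) = (Kernel.const A l).comap Prod.fst measurable_fst := by
    ext a; simp
  have : IsProbabilityMeasure ((m ⊗ₘ κ').map (sw A B T)) :=
    Measure.isProbabilityMeasure_map (sw A B T).measurable.aemeasurable
  have hJ : ((m ⊗ₘ κ').map (sw A B T)).fst = m.fst ⊗ₘ κ := by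
    rw [← h, Measure.fst, Measure.map_map measurable_fst (sw A B T).measurable]
    rfl
  have hJ2 := ((m ⊗ₘ κ').map (sw A B T)).disintegrate ((m ⊗ₘ κ').map (sw A B T)).condKernel
  rw [hJ] at hJ2
  rw [hc, ← klDiv_map_equiv (sw A B T) (m ⊗ₘ κ'),
    ← klDiv_map_equiv (sw A B T) (m ⊗ₘ κ') (m ⊗ₘ (κ.comap Prod.fst measurable_fst)),
    map_sw_compProd, map_sw_compProd, ← hJ2]
  exact InformationTheory.klDiv_compProd_eq_add _ _ _ _

end chain

section step

variable {Ω Θ 𝒴 : Type*} [MeasurableSpace Ω] [MeasurableSpace Θ] [MeasurableSpace 𝒴]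
    [StandardBorelSpace Θ] [StandardBorelSpace 𝒴] [Nonempty 𝒴]

lemma step (P : Measure Ω) [IsProbabilityMeasure P] (k : ℕ)
    (θ : Ω → Θ) (hθ : Measurable θ)
    (Y : ℕ → Ω → 𝒴) (hY : ∀ i < k + 1, Measurable (Y i))
    (κ' : Kernel (Fin (k + 1) → 𝒴) Θ) [IsMarkovKernel κ']
    (κ : Kernel (Fin k → 𝒴) Θ) [IsMarkovKernel κ]
    (hκ' : P.map (fun ω => ((fun i : Fin (k + 1) => Y i ω), θ ω))
        = (P.map (fun ω (i : Fin (k + 1)) => Y i ω)) ⊗ₘ κ')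
    (hκ : P.map (fun ω => ((fun i : Fin k => Y i ω), θ ω))
        = (P.map (fun ω (i : Fin k) => Y i ω)) ⊗ₘ κ)
    (l : Measure Θ) [IsProbabilityMeasure l] :
    ∫⁻ ω, klDiv (κ' (fun i : Fin (k + 1) => Y i ω)) l ∂P
      = ∫⁻ ω, klDiv (κ (fun i : Fin k => Y i ω)) l ∂P
        + ∫⁻ ω, klDiv (κ' (fun i : Fin (k + 1) => Y i ω)) (κ (fun i : Fin k => Y i ω)) ∂P := by
  have hH : Measurable (fun ω (i : Fin k) => Y i ω) :=
    measurable_pi_lambda _ fun i => hY i (by omega)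
  have hH' : Measurable (fun ω (i : Fin (k + 1)) => Y i ω) :=
    measurable_pi_lambda _ fun i => hY i (by omega)
  have hYk : Measurable (Y k) := hY k (by omega)
  have hX : Measurable (fun ω => ((fun i : Fin k => Y i ω), Y k ω)) := hH.prodMk hYk
  have hg : Measurable (fun p : (Fin k → 𝒴) × 𝒴 => (Fin.snoc p.1 p.2 : Fin (k + 1) → 𝒴)) := by
    refine measurable_pi_lambda _ fun i => ?_
    refine Fin.lastCases ?_ (fun j => ?_) i
    · simpa using measurable_snd
    · simp only [Fin.snoc_castSucc]; fun_prop
  have hgX : ∀ ω, (Fin.snoc (fun i : Fin k => Y i ω) (Y k ω) : Fin (k + 1) → 𝒴)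
      = fun i : Fin (k + 1) => Y i ω := by
    intro ω
    funext i
    refine Fin.lastCases ?_ (fun j => ?_) i <;> simp
  set m := P.map (fun ω => ((fun i : Fin k => Y i ω), Y k ω)) with hm
  have : IsProbabilityMeasure m := Measure.isProbabilityMeasure_map hX.aemeasurable
  have hfst : m.fst = P.map (fun ω (i : Fin k) => Y i ω) := Measure.fst_map_prodMk hYk
  have : IsProbabilityMeasure (P.map (fun ω (i : Fin k) => Y i ω)) :=
    Measure.isProbabilityMeasure_map hH.aemeasurable
  have : IsProbabilityMeasure (P.map (fun ω (i : Fin (k + 1)) => Y i ω)) :=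
    Measure.isProbabilityMeasure_map hH'.aemeasurable
  -- the joint law, in terms of `m`
  have hjoint : P.map (fun ω => (((fun i : Fin k => Y i ω), Y k ω), θ ω))
      = m ⊗ₘ (κ'.comap _ hg) := by
    have hs : Measurable (fun p : (Fin (k + 1) → 𝒴) × Θ =>
        (((fun i : Fin k => p.1 i.castSucc), p.1 (Fin.last k)), p.2)) := by fun_prop
    have h1 : P.map (fun ω => (((fun i : Fin k => Y i ω), Y k ω), θ ω))
        = (P.map (fun ω => ((fun i : Fin (k + 1) => Y i ω), θ ω))).map
          (fun p : (Fin (k + 1) → 𝒴) × Θ =>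
            (((fun i : Fin k => p.1 i.castSucc), p.1 (Fin.last k)), p.2)) := by
      rw [Measure.map_map hs (hH'.prodMk hθ)]
      rfl
    rw [h1, hκ']
    refine Measure.ext_of_lintegral _ fun f hf => ?_
    have hfs : Measurable (fun p : (Fin (k + 1) → 𝒴) × Θ =>
        f (((fun i : Fin k => p.1 i.castSucc), p.1 (Fin.last k)), p.2)) := hf.comp hs
    rw [lintegral_map hf hs, Measure.lintegral_compProd hfs,
      lintegral_map (Measurable.lintegral_kernel_prod_right' hfs) hH',
      Measure.lintegral_compProd hf,
      lintegral_map (Measurable.lintegral_kernel_prod_right' hf) hX]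
    refine lintegral_congr fun ω => ?_
    simp only [Kernel.comap_apply, hgX]
    rfl
  have hmarg : (m ⊗ₘ (κ'.comap _ hg)).map (fun p => (p.1.1, p.2)) = m.fst ⊗ₘ κ := by
    rw [← hjoint, hfst, ← hκ, Measure.map_map (by fun_prop) (hX.prodMk hθ)]
    rfl
  have key := chain m (κ'.comap _ hg) κ l hmarg
  rw [klDiv_compProd_right, klDiv_compProd_right, klDiv_compProd_right, hfst,
    lintegral_map (measurable_klDiv_kernel _ _) hX, lintegral_map (measurable_klDiv_kernel _ _) hH,
    lintegral_map (measurable_klDiv_kernel _ _) hX] at key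
  simpa only [Kernel.comap_apply, hgX, Kernel.const_apply] using key

end step

end IncTerm

/-- Equivalence of the incremental and terminal expected information-gain
formulations of sequential optimal experimental design. -/
theorem incremental_eq_terminal_expected_information_gain
    {Ω Θ 𝒴 : Type*} [MeasurableSpace Ω] [MeasurableSpace Θ] [MeasurableSpace 𝒴]
    [StandardBorelSpace Θ] [Nonempty Θ] [StandardBorelSpace 𝒴] [Nonempty 𝒴]
    (P : Measure Ω) [IsProbabilityMeasure P]
    (N : ℕ) (hN : 0 < N)
    (θ : Ω → Θ) (hθ : Measurable θ)
    (Y : ℕ → Ω → 𝒴) (hY : ∀ i < N, Measurable (Y i))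
    -- `π k` is a regular conditional distribution of `θ` given `(Y 0, …, Y (k-1))`,
    -- i.e. a Markov kernel disintegrating the joint law of the history and `θ`.
    (π : (k : ℕ) → Kernel (Fin k → 𝒴) Θ)
    (hπMarkov : ∀ k ≤ N, IsMarkovKernel (π k))
    (hπ : ∀ k ≤ N,
      P.map (fun ω => ((fun i : Fin k => Y i ω), θ ω))
        = (P.map (fun ω (i : Fin k) => Y i ω)) ⊗ₘ (π k))
    -- `π 0` is the (unconditional) law of `θ`.
    (hπ0 : ∀ h : Fin 0 → 𝒴, π 0 h = P.map θ) :
    ∑ k ∈ Finset.range N,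
        ∫⁻ ω, klDiv (π (k + 1) (fun i : Fin (k + 1) => Y i ω))
          (π k (fun i : Fin k => Y i ω)) ∂P
      = ∫⁻ ω, klDiv (π N (fun i : Fin N => Y i ω)) (π 0 (fun i : Fin 0 => Y i ω)) ∂P := by
  have hl : IsProbabilityMeasure (P.map θ) := Measure.isProbabilityMeasure_map hθ.aemeasurable
  simp_rw [hπ0]
  have main : ∀ n ≤ N, ∑ k ∈ Finset.range n,
        ∫⁻ ω, klDiv (π (k + 1) (fun i : Fin (k + 1) => Y i ω))
          (π k (fun i : Fin k => Y i ω)) ∂P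
      = ∫⁻ ω, klDiv (π n (fun i : Fin n => Y i ω)) (P.map θ) ∂P := by
    intro n
    induction n with
    | zero =>
      intro _
      simp [hπ0, IncTerm.klDiv_eq]
    | succ n ih =>
      intro hn
      have := hπMarkov n (by omega)
      have := hπMarkov (n + 1) hn
      rw [Finset.sum_range_succ, ih (by omega)]
      exact (IncTerm.step P n θ hθ Y (fun i hi => hY i (by omega)) (π (n + 1)) (π n)
        (hπ (n + 1) hn) (hπ n (by omega)) (P.map θ)).symm
  exact main N le_rfl
end

section
/- Let X (states), D (designs), and Y (observations) be standard Borel spaces and N a positive integer. Let O_k : X × D → P(Y) be Markov kernels, F_k : X × D × Y → X measurable maps, g_k : X × D × Y → ℝ bounded measurable for k = 0,…,N−1, g_N : X → ℝ bounded measurable, and μ_k : X → D measurable for k = 0,…,N−1. For 0 ≤ k ≤ N−1 and (x, d) ∈ X × D, define the action-value function Q_k(x, d) as the expectation of g_k(x, d, Y_k) + Σ_{t=k+1}^{N−1} g_t(X_t, μ_t(X_t), Y_t) + g_N(X_N) under the trajectory law in which Y_k ∼ O_k(x, d), X_{k+1} = F_k(x, d, Y_k), and for t > k, Y_t ∼ O_t(X_t,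 μ_t(X_t)) and X_{t+1} = F_t(X_t, μ_t(X_t), Y_t) (this law being given by iterated composition of the kernels). Then the action-value functions satisfy the one-step Bellman recursion: Q_{N−1}(x, d) = ∫_Y [ g_{N−1}(x, d, y) + g_N(F_{N−1}(x, d, y)) ] dO_{N−1}(x, d)(y), and for 0 ≤ k ≤ N−2, Q_k(x, d) = ∫_Y [ g_k(x, d, y) + Q_{k+1}( F_k(x, d, y), μ_{k+1}(F_k(x, d, y)) ) ] dO_k(x, d)(y). -/
open MeasureTheory ProbabilityTheory

/-- The trajectory law on the remaining `j` observations, starting from stage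
`k` at state `x` with design `d`: draw `y_k ∼ O k (x, d)`, update the state via
`F`, choose the next design by the policy `pol`, and iterate. -/
noncomputable def trajLaw {X D Y : Type*}
    [MeasurableSpace X] [MeasurableSpace D] [MeasurableSpace Y]
    (O : ℕ → Kernel (X × D) Y) (F : ℕ → X → D → Y → X) (pol : ℕ → X → D) :
    (k : ℕ) → (j : ℕ) → X → D → Measure (Fin j → Y)
  | _, 0, _, _ => Measure.dirac fun i => i.elim0
  | k, j + 1, x, d => (O k (x, d)).bind fun y =>
      (trajLaw O F pol (k + 1) j (F k x d y) (pol (k + 1) (F k x d y))).map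
        (Fin.cons y)

/-- The total reward accumulated over the remaining `j` stages, starting from
stage `k` at state `x` with design `d`, along the observation sequence `ys`,
with subsequent designs chosen by the policy `pol`. -/
def totalReward {X D Y : Type*} (F : ℕ → X → D → Y → X) (pol : ℕ → X → D)
    (g : ℕ → X → D → Y → ℝ) (gN : X → ℝ) :
    (k : ℕ) → (j : ℕ) → X → D → (Fin j → Y) → ℝ
  | _, 0, x, _, _ => gN x
  | k, j + 1, x, d, ys =>
      g k x d (ys 0) +
        totalReward F pol g gN (k + 1) j (F k x d (ys 0))
          (pol (k + 1) (F k x d (ys 0))) (fun i => ys i.succ)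

/-- The action-value function `Q_k(x, d)`: the expectation of the total
remaining reward under the trajectory law from stage `k` started at `(x, d)`,
in an `N`-experiment horizon. -/
noncomputable def qValue {X D Y : Type*}
    [MeasurableSpace X] [MeasurableSpace D] [MeasurableSpace Y]
    (O : ℕ → Kernel (X × D) Y) (F : ℕ → X → D → Y → X) (pol : ℕ → X → D)
    (g : ℕ → X → D → Y → ℝ) (gN : X → ℝ) (N : ℕ) (k : ℕ) (x : X) (d : D) : ℝ :=
  ∫ ys, totalReward F pol g gN k (N - k) x d ys ∂(trajLaw O F pol k (N - k) x d)


theorem aux_map {X D Y : Type*}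
    [MeasurableSpace X] [MeasurableSpace D] [MeasurableSpace Y]
    (O : ℕ → Kernel (X × D) Y) (F : ℕ → X → D → Y → X) (pol : ℕ → X → D) (k j : ℕ)
    [IsMarkovKernel (O k)]
    (hF : Measurable fun p : (X × D) × Y => F k p.1.1 p.1.2 p.2)
    (T : Kernel X (Fin j → Y)) [IsMarkovKernel T]
    (hT : ∀ x, T x = trajLaw O F pol (k + 1) j x (pol (k + 1) x)) (x : X) (d : D) :
    trajLaw O F pol k (j + 1) x d =
      ((O k ⊗ₖ T.comap _ hF) (x, d)).map
        (fun q : Y × (Fin j → Y) => (Fin.cons q.1 q.2 : Fin (j + 1) → Y)) := by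
  have hc : Measurable (fun q : Y × (Fin j → Y) => (Fin.cons q.1 q.2 : Fin (j + 1) → Y)) := by
    refine measurable_pi_iff.2 fun i => ?_
    refine Fin.cases ?_ (fun i => ?_) i
    · simpa using measurable_fst
    · simpa [Function.comp_def] using (measurable_pi_apply i).comp measurable_snd
  have hFx : Measurable fun y => F k x d y := hF.comp (measurable_prodMk_left (x := (x, d)))
  have e : ∀ y : Y, (trajLaw O F pol (k + 1) j (F k x d y) (pol (k + 1) (F k x d y))).map
        (Fin.cons y) = ((Kernel.id ×ₖ T.comap _ hFx).map
        (fun q : Y × (Fin j → Y) => (Fin.cons q.1 q.2 : Fin (j + 1) → Y))) y := by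
    intro y
    rw [← hT, Kernel.map_apply _ hc, Kernel.prod_apply, Kernel.id_apply, Kernel.comap_apply,
      Measure.dirac_prod, Measure.map_map hc measurable_prodMk_left]
    rfl
  rw [trajLaw, funext e]
  ext s hs
  rw [Measure.bind_apply hs (Kernel.aemeasurable _), Measure.map_apply hc hs,
    Kernel.compProd_apply (hc hs)]
  refine lintegral_congr fun y => ?_
  have hcy : Measurable (fun q : Fin j → Y => (Fin.cons y q : Fin (j + 1) → Y)) :=
    hc.comp (measurable_prodMk_left (x := y))
  rw [← e, ← hT]
  exact Measure.map_apply hcy hs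

theorem aux_ker {X D Y : Type*}
    [MeasurableSpace X] [MeasurableSpace D] [MeasurableSpace Y]
    (N : ℕ)
    (O : ℕ → Kernel (X × D) Y) (hO : ∀ k < N, IsMarkovKernel (O k))
    (F : ℕ → X → D → Y → X)
    (hF : ∀ k < N, Measurable fun p : (X × D) × Y => F k p.1.1 p.1.2 p.2)
    (pol : ℕ → X → D) (hpol : ∀ k < N, Measurable (pol k)) (j : ℕ) :
    ∀ k, k + j ≤ N → 
      (∃ T : Kernel X (Fin j → Y), IsMarkovKernel T ∧ ∀ x, T x = trajLaw O F pol k j x (pol k x)) 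
      := by
  induction j with
  | zero =>
    intro k _
    exact ⟨Kernel.const _ (Measure.dirac fun i => i.elim0), inferInstance, fun x => by
      rw [trajLaw, Kernel.const_apply]⟩
  | succ j ih =>
    intro k hk
    obtain ⟨T, hT, h⟩ := ih (k + 1) (by omega)
    have := hO k (by omega)
    have hp := hpol k (by omega)
    have hc : Measurable (fun q : Y × (Fin j → Y) => (Fin.cons q.1 q.2 : Fin (j + 1) → Y)) := by
      refine measurable_pi_iff.2 fun i => ?_
      refine Fin.cases ?_ (fun i => ?_) i
      · simpa using measurable_fst
      · simpa [Function.comp_def] using (measurable_pi_apply i).comp measurable_snd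
    have hq : Measurable fun x => (x, pol k x) := measurable_id.prodMk hp
    refine ⟨((O k ⊗ₖ T.comap _ (hF k (by omega))).map 
        (fun q : Y × (Fin j → Y) => (Fin.cons q.1 q.2 : Fin (j + 1) → Y))).comap _ hq, ?_, ?_⟩
    · have := Kernel.IsMarkovKernel.map (O k ⊗ₖ T.comap _ (hF k (by omega))) hc
      infer_instance
    · intro x
      rw [aux_map O F pol k j (hF k (by omega)) T h, Kernel.comap_apply, Kernel.map_apply _ hc]

theorem aux_reward {X D Y : Type*}
    [MeasurableSpace X] [MeasurableSpace D] [MeasurableSpace Y]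
    (N : ℕ)
    (F : ℕ → X → D → Y → X)
    (hF : ∀ k < N, Measurable fun p : (X × D) × Y => F k p.1.1 p.1.2 p.2)
    (g : ℕ → X → D → Y → ℝ)
    (hg : ∀ k < N, Measurable fun p : X × D × Y => g k p.1 p.2.1 p.2.2)
    (hgBdd : ∀ k < N, ∃ C, ∀ x d y, |g k x d y| ≤ C)
    (gN : X → ℝ) (hgN : Measurable gN) (hgNBdd : ∃ C, ∀ x, |gN x| ≤ C)
    (pol : ℕ → X → D) (hpol : ∀ k < N, Measurable (pol k)) (j : ℕ) :
    ∀ k, k + j ≤ N →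
      (Measurable fun p : X × (Fin j → Y) => totalReward F pol g gN k j p.1 (pol k p.1) p.2) ∧
      ∃ C, ∀ x d ys, |totalReward F pol g gN k j x d ys| ≤ C := by
  induction j with
  | zero =>
    intro k _
    simp only [totalReward]
    exact ⟨hgN.comp measurable_fst, hgNBdd.imp fun C h x _ _ => h x⟩
  | succ j ih =>
    intro k hk
    obtain ⟨hm, C, hC⟩ := ih (k + 1) (by omega)
    have hp := hpol k (by omega)
    have hFk := hF k (by omega)
    have hgk := hg k (by omega)
    obtain ⟨C', hC'⟩ := hgBdd k (by omega)
    simp only [totalReward]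
    refine ⟨?_, C' + C, fun x d ys => (abs_add_le _ _).trans (add_le_add (hC' _ _ _) (hC _ _ _))⟩
    have h0 : Measurable fun p : X × (Fin (j + 1) → Y) => p.2 0 :=
      (measurable_pi_apply 0).comp measurable_snd
    have hp' : Measurable fun p : X × (Fin (j + 1) → Y) => pol k p.1 := hp.comp measurable_fst
    refine Measurable.add (hgk.comp (measurable_fst.prodMk (hp'.prodMk h0))) ?_
    refine hm.comp ((hFk.comp ((measurable_fst.prodMk hp').prodMk h0)).prodMk ?_)
    exact measurable_pi_iff.2 fun i => (measurable_pi_apply _).comp measurable_snd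

theorem aux_step {X D Y : Type*}
    [MeasurableSpace X] [MeasurableSpace D] [MeasurableSpace Y]
    (N : ℕ)
    (O : ℕ → Kernel (X × D) Y) (hO : ∀ k < N, IsMarkovKernel (O k))
    (F : ℕ → X → D → Y → X)
    (hF : ∀ k < N, Measurable fun p : X × D × Y => F k p.1 p.2.1 p.2.2)
    (g : ℕ → X → D → Y → ℝ)
    (hg : ∀ k < N, Measurable fun p : X × D × Y => g k p.1 p.2.1 p.2.2)
    (hgBdd : ∀ k < N, ∃ C, ∀ x d y, |g k x d y| ≤ C)
    (gN : X → ℝ) (hgN : Measurable gN) (hgNBdd : ∃ C, ∀ x, |gN x| ≤ C)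
    (pol : ℕ → X → D) (hpol : ∀ k < N, Measurable (pol k)) (k j : ℕ) (hk : k + (j + 1) ≤ N)
    (x : X) (d : D) :
    ∫ ys, totalReward F pol g gN k (j + 1) x d ys ∂(trajLaw O F pol k (j + 1) x d) =
    ∫ y, (g k x d y + ∫ ys, totalReward F pol g gN (k + 1) j (F k x d y)
      (pol (k + 1) (F k x d y)) ys ∂(trajLaw O F pol (k + 1) j (F k x d y)
      (pol (k + 1) (F k x d y)))) ∂(O k (x, d)) := by
  have hF' : ∀ k < N, Measurable fun p : (X × D) × Y => F k p.1.1 p.1.2 p.2 := fun k hk =>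
    (hF k hk).comp (measurable_fst.fst.prodMk (measurable_fst.snd.prodMk measurable_snd))
  obtain ⟨T, hT, h⟩ := aux_ker N O hO F hF' pol hpol j (k + 1) (by omega)
  obtain ⟨hm, C, hC⟩ := aux_reward N F hF' g hg hgBdd gN hgN hgNBdd pol hpol j (k + 1) (by omega)
  have := hO k (by omega)
  have hFk := hF k (by omega)
  have hgk := hg k (by omega)
  obtain ⟨C', hC'⟩ := hgBdd k (by omega)
  have hc : Measurable (fun q : Y × (Fin j → Y) => (Fin.cons q.1 q.2 : Fin (j + 1) → Y)) := by
    refine measurable_pi_iff.2 fun i => ?_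
    refine Fin.cases ?_ (fun i => ?_) i
    · simpa using measurable_fst
    · simpa [Function.comp_def] using (measurable_pi_apply i).comp measurable_snd
  have hy : ∀ {Z : Type _} [MeasurableSpace Z] {f : Z → Y}, Measurable f →
      Measurable fun z => (x, d, f z) := fun hf =>
    measurable_const.prodMk (measurable_const.prodMk hf)
  have h0 : Measurable fun p : (Fin (j + 1) → Y) => p 0 := measurable_pi_apply 0
  have hR : Measurable fun ys => totalReward F pol g gN k (j + 1) x d ys := by
    simp only [totalReward]
    refine Measurable.add (hgk.comp (hy h0)) ?_
    refine hm.comp ((hFk.comp (hy h0)).prodMk ?_)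
    exact measurable_pi_iff.2 fun i => measurable_pi_apply _
  rw [aux_map O F pol k j (hF' k (by omega)) T h, integral_map hc.aemeasurable
    hR.aestronglyMeasurable, integral_compProd]
  · refine integral_congr_ae (Filter.Eventually.of_forall fun y => ?_)
    simp only [totalReward, Fin.cons_zero, Fin.cons_succ, Kernel.comap_apply]
    rw [← h, integral_add (integrable_const _), integral_const]
    · simp
    · exact Integrable.of_bound (hm.comp measurable_prodMk_left).aestronglyMeasurable C
        (Filter.Eventually.of_forall fun ys => hC _ _ _)
  · refine Integrable.of_bound (hR.comp hc).aestronglyMeasurable (C' + C)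
      (Filter.Eventually.of_forall fun ys => ?_)
    simp only [totalReward]
    exact (abs_add_le _ _).trans (add_le_add (hC' _ _ _) (hC _ _ _))

/-- The action-value functions defined through the trajectory law satisfy the
one-step Bellman recursion. -/
theorem qValue_bellman_recursion {X D Y : Type*}
    [MeasurableSpace X] [MeasurableSpace D] [MeasurableSpace Y]
    (N : ℕ) (hN : 0 < N)
    (O : ℕ → Kernel (X × D) Y) (hO : ∀ k < N, IsMarkovKernel (O k))
    (F : ℕ → X → D → Y → X)
    (hF : ∀ k < N, Measurable fun p : X × D × Y => F k p.1 p.2.1 p.2.2)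
    (g : ℕ → X → D → Y → ℝ)
    (hg : ∀ k < N, Measurable fun p : X × D × Y => g k p.1 p.2.1 p.2.2)
    (hgBdd : ∀ k < N, ∃ C, ∀ x d y, |g k x d y| ≤ C)
    (gN : X → ℝ) (hgN : Measurable gN) (hgNBdd : ∃ C, ∀ x, |gN x| ≤ C)
    (pol : ℕ → X → D) (hpol : ∀ k < N, Measurable (pol k)) :
    (∀ x d, qValue O F pol g gN N (N - 1) x d
        = ∫ y, (g (N - 1) x d y + gN (F (N - 1) x d y)) ∂(O (N - 1) (x, d)))
      ∧ ∀ k, k + 2 ≤ N → ∀ x d,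
          qValue O F pol g gN N k x d
            = ∫ y, (g k x d y +
                qValue O F pol g gN N (k + 1) (F k x d y)
                  (pol (k + 1) (F k x d y))) ∂(O k (x, d)) := by
  refine ⟨fun x d => ?_, fun k hk x d => ?_⟩
  · have e : N - (N - 1) = 0 + 1 := by omega
    unfold qValue
    rw [e, aux_step N O hO F hF g hg hgBdd gN hgN hgNBdd pol hpol (N - 1) 0 (by omega)]
    simp [totalReward, trajLaw]
  · unfold qValue
    obtain ⟨j, rfl⟩ : ∃ j, N = k + 1 + j := ⟨N - (k + 1), by omega⟩
    have e : k + 1 + j - k = j + 1 := by omega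
    have e' : k + 1 + j - (k + 1) = j := by omega
    rw [e, e', aux_step (k + 1 + j) O hO F hF g hg hgBdd gN hgN hgNBdd pol hpol k j (by omega)]
end
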